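/- Let W be a symmetric B-DMC and G a polarizing ℓ×ℓ matrix over GF(2). Then there exists an index i ∈ {1,…,ℓ} such that the split channel W^{(i)} defined from W and G satisfies Z(W^{(i)}) ≤ Z(W)². -/

import Mathlib

open scoped BigOperators

/-- A binary-input DMC with finite output alphabet `Y`. -/
def IsBDMC {Y : Type} [Fintype Y] (W : ZMod 2 → Y → ℝ) : Prop :=
  (∀ x y, 0 ≤ W x y) ∧ ∀ x, ∑ y, W x y = 1

/-- Symmetry of a B-DMC. -/
def IsSymmetricBDMC {Y : Type} [Fintype Y] (W : ZMod 2 → Y → ℝ) : Prop :=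
  ∃ π : Y → Y, Function.Involutive π ∧ ∀ y, W 1 y = W 0 (π y)

/-- Symmetric mutual information `I(W)` (base-2 logarithm). -/
noncomputable def mutualInfo {Y : Type} [Fintype Y] (W : ZMod 2 → Y → ℝ) : ℝ :=
  ∑ y, ∑ x : ZMod 2,
    (1 / 2) * W x y * Real.logb 2 (W x y / ((1 / 2) * W 0 y + (1 / 2) * W 1 y))

/-- Bhattacharyya parameter `Z(W)`. -/
noncomputable def bhatt {Y : Type} [Fintype Y] (W : ZMod 2 → Y → ℝ) : ℝ :=
  ∑ y, Real.sqrt (W 0 y * W 1 y)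

/-- The split channel `W^{(i)}` (here `i : Fin m` is 0-based). -/
noncomputable def splitChannel {Y : Type} [Fintype Y] {m : ℕ}
    (W : ZMod 2 → Y → ℝ) (G : Matrix (Fin m) (Fin m) (ZMod 2)) (i : Fin m) :
    ZMod 2 → ((Fin m → Y) × (Fin i.val → ZMod 2)) → ℝ :=
  fun ui z =>
    (1 / 2 ^ (m - 1)) *
      ∑ u ∈ Finset.univ.filter
          (fun u : Fin m → ZMod 2 =>
            u i = ui ∧ ∀ j : Fin i.val, u (Fin.castLE i.isLt.le j) = z.2 j),
        ∏ j, W (Matrix.vecMul u G j) (z.1 j)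

/-- The channel `W^k` (k independent uses of `W` with the same input). -/
noncomputable def prodChannel {Y : Type} [Fintype Y] (W : ZMod 2 → Y → ℝ) (k : ℕ) :
    ZMod 2 → (Fin k → Y) → ℝ :=
  fun x y => ∏ j, W x (y j)

def IsUpperTriangular {l : ℕ} (M : Matrix (Fin l) (Fin l) (ZMod 2)) : Prop :=
  ∀ i j : Fin l, j < i → M i j = 0

/-- `G` is polarizing: invertible and no column permutation is upper triangular. -/
def IsPolarizing {l : ℕ} (G : Matrix (Fin l) (Fin l) (ZMod 2)) : Prop :=
  IsUnit G.det ∧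
    ∀ σ : Equiv.Perm (Fin l), ¬ IsUpperTriangular (Matrix.of fun i j => G i (σ j))

/-- `n`-th Kronecker power of `G`, as an `ℓ^n × ℓ^n` matrix. -/
def kronPow {l : ℕ} (G : Matrix (Fin l) (Fin l) (ZMod 2)) :
    (n : ℕ) → Matrix (Fin (l ^ n)) (Fin (l ^ n)) (ZMod 2)
  | 0 => 1
  | n + 1 =>
      Matrix.reindex (finProdFinEquiv.trans (finCongr (pow_succ' l n).symm))
        (finProdFinEquiv.trans (finCongr (pow_succ' l n).symm))
        (Matrix.kroneckerMap (· * ·) G (kronPow G n))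

section Bhattacharyya

variable {Y : Type} [Fintype Y]

theorem bhatt_nonneg (W : ZMod 2 → Y → ℝ) : 0 ≤ bhatt W :=
  Finset.sum_nonneg fun _ _ => Real.sqrt_nonneg _

theorem IsBDMC.bhatt_le_one {W : ZMod 2 → Y → ℝ} (hW : IsBDMC W) : bhatt W ≤ 1 := by
  have h : ∀ y ∈ Finset.univ, √(W 0 y * W 1 y) ≤ (W 0 y + W 1 y) / 2 := fun y _ => by
    have h0 := hW.1 0 y
    have h1 := hW.1 1 y
    refine Real.sqrt_le_iff.2 ⟨by positivity, ?_⟩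
    nlinarith [sq_nonneg (W 0 y - W 1 y)]
  refine (Finset.sum_le_sum h).trans ?_
  rw [← Finset.sum_div, Finset.sum_add_distrib, hW.2, hW.2]
  norm_num

/-- The Bhattacharyya parameter does not change when the input is shifted. -/
theorem sum_sqrt_mul_eq_bhatt (W : ZMod 2 → Y → ℝ) {a b : ZMod 2} (hab : a ≠ b) :
    ∑ y, √(W a y * W b y) = bhatt W := by
  have h : a = 0 ∧ b = 1 ∨ a = 1 ∧ b = 0 := by
    revert a b
    decide
  rcases h with ⟨rfl, rfl⟩ | ⟨rfl, rfl⟩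
  · rfl
  · simp only [bhatt, mul_comm]

end Bhattacharyya

section Pivot

variable {l : ℕ}

/-- `pivotCols σ i` is the set of the columns `σ k` for the rows `k` below row `i`. -/
def pivotCols (σ : Fin l → Fin l) (i : Fin l) : Finset (Fin l) :=
  (Finset.Ioi i).image σ

theorem mem_pivotCols {σ : Fin l → Fin l} {i j : Fin l} :
    j ∈ pivotCols σ i ↔ ∃ k, i < k ∧ σ k = j := by
  simp [pivotCols]

theorem card_pivotCols {σ : Fin l → Fin l} {i : Fin l} (hσ : Set.InjOn σ (Set.Ioi i)) :
    (pivotCols σ i).card = l - 1 - i := by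
  rw [pivotCols, Finset.card_image_of_injOn (by simpa using hσ), Fin.card_Ioi]

/-- Unless the columns of `G` can be permuted to make it upper triangular, some row of `G` has two
nonzero entries outside a set of columns that supports all the rows below it and has as many
elements as there are such rows. -/
theorem exists_two_ne_zero_notMem_pivotCols {G : Matrix (Fin l) (Fin l) (ZMod 2)}
    (hG : ∀ σ : Equiv.Perm (Fin l), ¬ IsUpperTriangular (Matrix.of fun i j => G i (σ j))) :
    ∃ (i : Fin l) (σ : Fin l → Fin l), Set.InjOn σ (Set.Ioi i) ∧
      (∀ k, i < k → ∀ j, G k j ≠ 0 → j ∈ pivotCols σ i) ∧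
      ∃ j₁ j₂, j₁ ≠ j₂ ∧ j₁ ∉ pivotCols σ i ∧ j₂ ∉ pivotCols σ i ∧ G i j₁ ≠ 0 ∧ G i j₂ ≠ 0 := by
  by_contra! hno
  have key : ∀ n ≤ l, ∃ σ : Fin l → Fin l, Set.InjOn σ {k | l - n ≤ k.val} ∧
      ∀ k : Fin l, l - n ≤ k.val → ∀ j, G k j ≠ 0 → ∃ k', k ≤ k' ∧ σ k' = j := by
    intro n
    induction n with
    | zero =>
      intro _
      exact ⟨id, Function.injective_id.injOn, fun k hk => absurd hk (by have := k.2; omega)⟩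
    | succ n ih =>
      intro hn
      obtain ⟨σ, hinj, hsupp⟩ := ih (by omega)
      let i : Fin l := ⟨l - (n + 1), by omega⟩
      have hi : ∀ k : Fin l, i < k ↔ l - n ≤ k.val := fun k => by
        simp only [Fin.lt_def, i]
        omega
      have hinj' : Set.InjOn σ (Set.Ioi i) := fun a ha b hb => hinj ((hi a).1 ha) ((hi b).1 hb)
      have hrow := hno i σ hinj' fun k hk j hj => by
        obtain ⟨k', hk', rfl⟩ := hsupp k ((hi k).1 hk) j hj
        exact mem_pivotCols.2 ⟨k', hk.trans_le hk', rfl⟩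
      obtain ⟨j₀, hj₀, hj₀'⟩ : ∃ j₀, j₀ ∉ pivotCols σ i ∧
          ∀ j, j ∉ pivotCols σ i → G i j ≠ 0 → j = j₀ := by
        by_cases h : ∃ j₀, j₀ ∉ pivotCols σ i ∧ G i j₀ ≠ 0
        · obtain ⟨j₀, h1, h2⟩ := h
          exact ⟨j₀, h1, fun j hj hjG => by_contra fun hne => h2 (hrow j j₀ hne hj h1 hjG)⟩
        · push Not at h
          obtain ⟨j₀, h1⟩ : ∃ j₀, j₀ ∉ pivotCols σ i := by
            by_contra! hall
            have hc := card_pivotCols hinj'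
            rw [Finset.eq_univ_of_forall hall, Finset.card_univ, Fintype.card_fin] at hc
            omega
          exact ⟨j₀, h1, fun j hj hjG => absurd (h j hj) hjG⟩
      have hcase : ∀ k : Fin l, l - (n + 1) ≤ k.val → k = i ∨ i < k := fun k hk =>
        (eq_or_lt_of_le (show i ≤ k from hk)).imp_left Eq.symm
      have hup : ∀ k, i < k → Function.update σ i j₀ k = σ k := fun k hk =>
        Function.update_of_ne hk.ne' _ _
      refine ⟨Function.update σ i j₀, fun a ha b hb hab => ?_, fun k hk j hj => ?_⟩
      · rcases hcase a ha with rfl | ha <;> rcases hcase b hb with rfl | hb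
        · rfl
        · rw [Function.update_self, hup b hb] at hab
          exact absurd (mem_pivotCols.2 ⟨b, hb, hab.symm⟩) hj₀
        · rw [Function.update_self, hup a ha] at hab
          exact absurd (mem_pivotCols.2 ⟨a, ha, hab⟩) hj₀
        · rw [hup a ha, hup b hb] at hab
          exact hinj' ha hb hab
      · rcases hcase k hk with rfl | hk
        · by_cases hjS : j ∈ pivotCols σ i
          · obtain ⟨k', hk', rfl⟩ := mem_pivotCols.1 hjS
            exact ⟨k', hk'.le, hup k' hk'⟩
          · exact ⟨i, le_rfl, by rw [Function.update_self, hj₀' j hjS hj]⟩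
        · obtain ⟨k', hk', rfl⟩ := hsupp k ((hi k).1 hk) j hj
          exact ⟨k', hk', hup k' (hk.trans_le hk')⟩
  obtain ⟨σ, hinj, hsupp⟩ := key l le_rfl
  have hσ : Function.Injective σ := fun a b hab => hinj (by simp) (by simp) hab
  refine hG (Equiv.ofBijective σ (Finite.injective_iff_bijective.1 hσ)) fun i j hij => ?_
  by_contra hne
  obtain ⟨k, hk, hkj⟩ := hsupp i (by simp) (σ j) hne
  exact absurd (hσ hkj ▸ hk) hij.not_ge

end Pivot

section SplitChannel

variable {Y : Type} [Fintype Y] {l : ℕ}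

/-- The input block `(z, x, 0, …, 0)`. -/
def inputPrefix (i : Fin l) (z : Fin i.val → ZMod 2) (x : ZMod 2) (j : Fin l) : ZMod 2 :=
  if h : j.val < i.val then z ⟨j, h⟩ else if j = i then x else 0

/-- The values allowed at position `j` to a vector that agrees with `c` outside `S`. -/
def agreeOff (S : Finset (Fin l)) (c : Fin l → ZMod 2) (j : Fin l) : Finset (ZMod 2) :=
  if j ∈ S then Finset.univ else {c j}

theorem mem_agreeOff {S : Finset (Fin l)} {c : Fin l → ZMod 2} {j : Fin l} {a : ZMod 2} :
    a ∈ agreeOff S c j ↔ (j ∉ S → a = c j) := by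
  by_cases h : j ∈ S <;> simp [agreeOff, h]

theorem card_piFinset_agreeOff (S : Finset (Fin l)) (c : Fin l → ZMod 2) :
    (Fintype.piFinset (agreeOff S c)).card = 2 ^ S.card := by
  have h : ∀ j, (agreeOff S c j).card = if j ∈ S then 2 else 1 := fun j => by
    by_cases h : j ∈ S <;> simp [agreeOff, h]
  simp [Fintype.card_piFinset, h]

theorem filter_eq_piFinset_agreeOff (i : Fin l) (z : Fin i.val → ZMod 2) (x : ZMod 2) :
    Finset.univ.filter (fun u : Fin l → ZMod 2 =>
      u i = x ∧ ∀ j : Fin i.val, u (Fin.castLE i.isLt.le j) = z j) =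
    Fintype.piFinset (agreeOff (Finset.Ioi i) (inputPrefix i z x)) := by
  ext u
  simp only [Finset.mem_filter, Finset.mem_univ, true_and, Fintype.mem_piFinset, mem_agreeOff,
    Finset.mem_Ioi, not_lt]
  constructor
  · rintro ⟨hi, hz⟩ j hj
    rcases hj.lt_or_eq with hj | rfl
    · simpa [inputPrefix, Fin.lt_def.1 hj] using hz ⟨j, hj⟩
    · simpa [inputPrefix] using hi
  · intro h
    refine ⟨by simpa [inputPrefix] using h i le_rfl, fun j => ?_⟩
    have hj : Fin.castLE i.isLt.le j ≤ i := Fin.le_def.2 j.2.le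
    simpa [inputPrefix] using h _ hj

/-- Encoding maps the input blocks with a given prefix onto a full affine coordinate subspace. -/
theorem image_vecMul_piFinset_agreeOff {G : Matrix (Fin l) (Fin l) (ZMod 2)} (hG : IsUnit G.det)
    {i : Fin l} {S : Finset (Fin l)} (hcard : S.card = l - 1 - i)
    (hsupp : ∀ k, i < k → ∀ j, G k j ≠ 0 → j ∈ S) (c : Fin l → ZMod 2) :
    (Fintype.piFinset (agreeOff (Finset.Ioi i) c)).image (fun u => Matrix.vecMul u G) =
      Fintype.piFinset (agreeOff S (Matrix.vecMul c G)) := by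
  have hinj : Function.Injective fun u => Matrix.vecMul u G :=
    Matrix.vecMul_injective_of_isUnit ((Matrix.isUnit_iff_isUnit_det G).2 hG)
  refine Finset.eq_of_subset_of_card_le (Finset.image_subset_iff.2 fun u hu => ?_) ?_
  · simp only [Fintype.mem_piFinset, mem_agreeOff, Finset.mem_Ioi, not_lt] at hu ⊢
    intro j hj
    simp only [Matrix.vecMul, dotProduct]
    refine Finset.sum_congr rfl fun k _ => ?_
    rcases le_or_gt k i with hk | hk
    · rw [hu k hk]
    · rw [not_not.1 (mt (hsupp k hk j) hj), mul_zero, mul_zero]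
  · rw [Finset.card_image_of_injective _ hinj, card_piFinset_agreeOff, card_piFinset_agreeOff,
      Fin.card_Ioi, hcard]

theorem splitChannel_eq_prod (W : ZMod 2 → Y → ℝ) {G : Matrix (Fin l) (Fin l) (ZMod 2)}
    (hG : IsUnit G.det) {i : Fin l} {S : Finset (Fin l)} (hcard : S.card = l - 1 - i)
    (hsupp : ∀ k, i < k → ∀ j, G k j ≠ 0 → j ∈ S) (x : ZMod 2) (y : Fin l → Y)
    (z : Fin i.val → ZMod 2) :
    splitChannel W G i x (y, z) = 1 / 2 ^ (l - 1) *
      ∏ j, ∑ a ∈ agreeOff S (Matrix.vecMul (inputPrefix i z x) G) j, W a (y j) := by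
  have hinj : Function.Injective fun u => Matrix.vecMul u G :=
    Matrix.vecMul_injective_of_isUnit ((Matrix.isUnit_iff_isUnit_det G).2 hG)
  rw [Finset.prod_univ_sum, ← image_vecMul_piFinset_agreeOff hG hcard hsupp,
    Finset.sum_image hinj.injOn, ← filter_eq_piFinset_agreeOff]
  rfl

theorem vecMul_inputPrefix_one (G : Matrix (Fin l) (Fin l) (ZMod 2)) (i : Fin l)
    (z : Fin i.val → ZMod 2) (j : Fin l) :
    Matrix.vecMul (inputPrefix i z 1) G j = Matrix.vecMul (inputPrefix i z 0) G j + G i j := by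
  have h : inputPrefix i z 1 = inputPrefix i z 0 + Pi.single i 1 := by
    ext k
    rcases lt_trichotomy k i with hk | rfl | hk
    · simp [inputPrefix, Fin.lt_def.1 hk, hk.ne]
    · simp [inputPrefix]
    · simp [inputPrefix, hk.ne', (Fin.lt_def.1 hk).not_gt]
  rw [h, Matrix.add_vecMul, Pi.add_apply, Matrix.single_one_vecMul]
  rfl

/-- A row with two nonzero entries outside the columns of the rows below it has a split channel
with squared Bhattacharyya parameter. -/
theorem IsBDMC.bhatt_splitChannel_le_sq {W : ZMod 2 → Y → ℝ} (hW : IsBDMC W)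
    {G : Matrix (Fin l) (Fin l) (ZMod 2)} (hG : IsUnit G.det) {i : Fin l} {S : Finset (Fin l)}
    (hcard : S.card = l - 1 - i) (hsupp : ∀ k, i < k → ∀ j, G k j ≠ 0 → j ∈ S) {j₁ j₂ : Fin l}
    (hne : j₁ ≠ j₂) (hj₁ : j₁ ∉ S) (hj₂ : j₂ ∉ S) (hG₁ : G i j₁ ≠ 0) (hG₂ : G i j₂ ≠ 0) :
    bhatt (splitChannel W G i) ≤ bhatt W ^ 2 := by
  let V (x : ZMod 2) (z : Fin i.val → ZMod 2) (j : Fin l) (y : Y) : ℝ :=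
    ∑ a ∈ agreeOff S (Matrix.vecMul (inputPrefix i z x) G) j, W a y
  have hV : ∀ x z j y, 0 ≤ V x z j y := fun x z j y => Finset.sum_nonneg fun a _ => hW.1 a y
  have hfactor : ∀ z j, ∑ y, √(V 0 z j y * V 1 z j y) ≤
      (if j ∈ S then 2 else 1) * (if j = j₁ then bhatt W else 1) *
        (if j = j₂ then bhatt W else 1) := by
    intro z j
    by_cases hjS : j ∈ S
    · have h1 : j ≠ j₁ := fun h => hj₁ (h ▸ hjS)
      have h2 : j ≠ j₂ := fun h => hj₂ (h ▸ hjS)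
      have hVy : ∀ x y, V x z j y = W 0 y + W 1 y := fun x y => by
        simp only [V, agreeOff, if_pos hjS]
        exact Fin.sum_univ_two fun a => W a y
      have hpos : ∀ y, 0 ≤ W 0 y + W 1 y := fun y => add_nonneg (hW.1 0 y) (hW.1 1 y)
      simp only [hVy, Real.sqrt_mul_self (hpos _), Finset.sum_add_distrib, hW.2, hjS, h1, h2,
        if_true, if_false]
      norm_num
    · have hVy : ∀ x y, V x z j y = W (Matrix.vecMul (inputPrefix i z x) G j) y := fun x y => by
        simp [V, agreeOff, hjS]
      simp only [hVy, vecMul_inputPrefix_one]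
      by_cases hGj : G i j = 0
      · have h1 : j ≠ j₁ := fun h => hG₁ (h ▸ hGj)
        have h2 : j ≠ j₂ := fun h => hG₂ (h ▸ hGj)
        simp [hGj, h1, h2, hjS, Real.sqrt_mul_self (hW.1 _ _), hW.2]
      · rw [sum_sqrt_mul_eq_bhatt W (by simpa using hGj)]
        by_cases h1 : j = j₁
        · simp [h1, hne, hj₁]
        · by_cases h2 : j = j₂
          · simp [h2, hne.symm, hj₂]
          · simpa [h1, h2, hjS] using hW.bhatt_le_one
  have hz : ∀ z, ∑ y : Fin l → Y, √(splitChannel W G i 0 (y, z) * splitChannel W G i 1 (y, z)) ≤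
      1 / 2 ^ (l - 1) * (2 ^ (l - 1 - i.val) * bhatt W ^ 2) := by
    intro z
    have hsqrt : ∀ y : Fin l → Y,
        √(splitChannel W G i 0 (y, z) * splitChannel W G i 1 (y, z)) =
          1 / 2 ^ (l - 1) * ∏ j, √(V 0 z j (y j) * V 1 z j (y j)) := fun y => by
      rw [splitChannel_eq_prod W hG hcard hsupp, splitChannel_eq_prod W hG hcard hsupp,
        mul_mul_mul_comm, ← Finset.prod_mul_distrib, Real.sqrt_mul (by positivity),
        Real.sqrt_mul_self (by positivity),
        Real.sqrt_prod _ fun j _ => mul_nonneg (hV 0 z j (y j)) (hV 1 z j (y j))]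
    have hprod : ∑ y : Fin l → Y, ∏ j, √(V 0 z j (y j) * V 1 z j (y j)) =
        ∏ j, ∑ y, √(V 0 z j y * V 1 z j y) := by
      rw [Finset.prod_univ_sum, Fintype.piFinset_univ]
    simp only [hsqrt]
    rw [← Finset.mul_sum, hprod]
    gcongr
    refine (Finset.prod_le_prod (fun j _ => Finset.sum_nonneg fun y _ => Real.sqrt_nonneg _)
      fun j _ => hfactor z j).trans_eq ?_
    rw [Finset.prod_mul_distrib, Finset.prod_mul_distrib, Finset.prod_ite_eq' Finset.univ j₁,
      Finset.prod_ite_eq' Finset.univ j₂, Finset.prod_ite]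
    simp [hcard, sq, mul_assoc]
  rw [bhatt, Fintype.sum_prod_type_right]
  refine (Finset.sum_le_sum fun z _ => hz z).trans_eq ?_
  have hpow : (2 : ℝ) ^ (l - 1) = 2 ^ i.val * 2 ^ (l - 1 - i.val) := by
    rw [← pow_add]
    congr 1
    omega
  simp only [Finset.sum_const, Finset.card_univ, Fintype.card_fun, ZMod.card, Fintype.card_fin,
    nsmul_eq_mul, hpow]
  push_cast
  field_simp

end SplitChannel

/-- For symmetric `W` and polarizing `G`, some split channel satisfies
`Z(W^{(i)}) ≤ Z(W)²`. -/
theorem exists_bhatt_splitChannel_le_sq {Y : Type} [Fintype Y] {l : ℕ}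
    (W : ZMod 2 → Y → ℝ) (hW : IsBDMC W) (hsym : IsSymmetricBDMC W)
    (G : Matrix (Fin l) (Fin l) (ZMod 2)) (hG : IsPolarizing G) :
    ∃ i : Fin l, bhatt (splitChannel W G i) ≤ bhatt W ^ 2 := by
  obtain ⟨i, σ, hinj, hsupp, j₁, j₂, hne, hj₁, hj₂, hG₁, hG₂⟩ :=
    exists_two_ne_zero_notMem_pivotCols hG.2
  exact ⟨i, hW.bhatt_splitChannel_le_sq hG.1 (card_pivotCols hinj) hsupp hne hj₁ hj₂ hG₁ hG₂⟩
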